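/- arXiv:1209.1667 — 3 statements merged into one kernel-verified Lean document; each statement's English description precedes it below -/
import Mathlib

section
/- Let E|k be a finite tamely ramified extension of non-Archimedean local fields. Then the following conditions are equivalent: (1) E is k-algebra isomorphic to a tensor product T ⊗_k L of a totally ramified extension T|k and an unramified extension L|k; (2) E contains an e-th root of some uniformizer of k, i.e. there exist a uniformizer π_k of k and α ∈ E with α^e = π_k; (3) 1 ∈ μ_tame(E|k); (4) there exist uniformizers π_E of E and π_k of k such that (π_E^e π_k^{−1})^{(q_E−1)/ẽ} ∈ 1 + 𝔭_E; (5) for all uniformizers π_E of E and π_k of k, the element (π_E^e π_k^{−1})^{(q_E−1)/ẽ} lies in 1 + 𝔭_E. -/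
noncomputable section

/-- Axioms expressing that `ν : K → EReal` is the additive valuation of a
non-Archimedean local (skew) field structure on `K`, normalized relatively to a base
field with valuation group `ℤ`, so that the value group of `K` is `(1/e)ℤ`; `K` is
complete and its residue field has exactly `q` elements (encoded by a complete finite
set of residue representatives). -/
structure IsLocalValuation (K : Type*) [DivisionRing K] (ν : K → EReal) (e q : ℕ) : Prop where
  e_pos : 0 < e
  one_lt_q : 1 < q
  eq_top_iff : ∀ x : K, ν x = ⊤ ↔ x = 0
  map_mul : ∀ x y : K, ν (x * y) = ν x + ν y
  min_le_add : ∀ x y : K, min (ν x) (ν y) ≤ ν (x + y)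
  values : ∀ x : K, x ≠ 0 → ∃ m : ℤ, ν x = ((m / e : ℝ) : EReal)
  exists_uniformizer : ∃ π : K, ν π = (((e : ℝ)⁻¹ : ℝ) : EReal)
  complete : ∀ x : ℕ → K,
      (∀ M : ℝ, ∃ N : ℕ, ∀ m ≥ N, ∀ n ≥ N, (M : EReal) ≤ ν (x m - x n)) →
      ∃ l : K, ∀ M : ℝ, ∃ N : ℕ, ∀ n ≥ N, (M : EReal) ≤ ν (x n - l)
  residue : ∃ s : Finset K, s.card = q ∧ (∀ y ∈ s, 0 ≤ ν y) ∧
      ∀ x : K, 0 ≤ ν x → ∃! y, y ∈ s ∧ 0 < ν (x - y)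

namespace IsLocalValuation

open IsLocalRing Polynomial

section Field

variable {K : Type*} [Field K] {ν : K → EReal} {e q : ℕ}

lemma map_zero (h : IsLocalValuation K ν e q) : ν 0 = ⊤ := (h.eq_top_iff 0).2 rfl

lemma exists_real (h : IsLocalValuation K ν e q) {x : K} (hx : x ≠ 0) : ∃ r : ℝ, ν x = r := by
  obtain ⟨m, hm⟩ := h.values x hx
  exact ⟨_, hm⟩

lemma ne_zero_of_eq_coe (h : IsLocalValuation K ν e q) {x : K} {r : ℝ} (hx : ν x = r) :
    x ≠ 0 := by
  rintro rfl
  rw [h.map_zero] at hx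
  exact EReal.coe_ne_top r hx.symm

lemma map_one (h : IsLocalValuation K ν e q) : ν 1 = 0 := by
  obtain ⟨r, hr⟩ := h.exists_real (one_ne_zero (α := K))
  have h1 := h.map_mul 1 1
  rw [mul_one, hr, ← EReal.coe_add, EReal.coe_eq_coe_iff] at h1
  rw [hr, show r = 0 by linarith, EReal.coe_zero]

lemma map_neg (h : IsLocalValuation K ν e q) (x : K) : ν (-x) = ν x := by
  obtain ⟨r, hr⟩ := h.exists_real (neg_ne_zero.2 (one_ne_zero (α := K)))
  have h1 := h.map_mul (-1) (-1)
  rw [neg_mul_neg, mul_one, hr, ← EReal.coe_add, h.map_one, ← EReal.coe_zero,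
    EReal.coe_eq_coe_iff] at h1
  rw [← neg_one_mul, h.map_mul, hr, show r = 0 by linarith, EReal.coe_zero, zero_add]

lemma map_sub_swap (h : IsLocalValuation K ν e q) (x y : K) : ν (x - y) = ν (y - x) := by
  rw [← h.map_neg, neg_sub]

lemma map_pow (h : IsLocalValuation K ν e q) {x : K} {r : ℝ} (hx : ν x = r) (n : ℕ) :
    ν (x ^ n) = ((n * r : ℝ) : EReal) := by
  induction n with
  | zero => simp [h.map_one]
  | succ n ih =>
    rw [pow_succ, h.map_mul, ih, hx, ← EReal.coe_add]
    congr 1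
    push_cast
    ring

lemma map_inv (h : IsLocalValuation K ν e q) {x : K} {r : ℝ} (hx : ν x = r) :
    ν x⁻¹ = ((-r : ℝ) : EReal) := by
  have hx0 := h.ne_zero_of_eq_coe hx
  obtain ⟨s, hs⟩ := h.exists_real (inv_ne_zero hx0)
  have h1 := h.map_mul x x⁻¹
  rw [mul_inv_cancel₀ hx0, h.map_one, hx, hs, ← EReal.coe_add, ← EReal.coe_zero,
    EReal.coe_eq_coe_iff] at h1
  rw [hs, show s = -r by linarith]

lemma map_mul_coe (h : IsLocalValuation K ν e q) {x y : K} {r s : ℝ} (hx : ν x = r)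
    (hy : ν y = s) : ν (x * y) = ((r + s : ℝ) : EReal) := by
  rw [h.map_mul, hx, hy, EReal.coe_add]

lemma le_map_add (h : IsLocalValuation K ν e q) {M : EReal} {x y : K} (hx : M ≤ ν x)
    (hy : M ≤ ν y) : M ≤ ν (x + y) := (le_min hx hy).trans (h.min_le_add x y)

lemma le_map_sub (h : IsLocalValuation K ν e q) {M : EReal} {x y : K} (hx : M ≤ ν x)
    (hy : M ≤ ν y) : M ≤ ν (x - y) := by
  rw [sub_eq_add_neg]
  exact h.le_map_add hx (by rwa [h.map_neg])

lemma lt_map_add (h : IsLocalValuation K ν e q) {M : EReal} {x y : K} (hx : M < ν x)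
    (hy : M < ν y) : M < ν (x + y) := (lt_min hx hy).trans_le (h.min_le_add x y)

lemma lt_map_sub (h : IsLocalValuation K ν e q) {M : EReal} {x y : K} (hx : M < ν x)
    (hy : M < ν y) : M < ν (x - y) := by
  rw [sub_eq_add_neg]
  exact h.lt_map_add hx (by rwa [h.map_neg])

lemma lt_map_sum (h : IsLocalValuation K ν e q) {ι : Type*} (s : Finset ι) (t : ι → K)
    {M : EReal} (hM : M ≠ ⊤) (ht : ∀ i ∈ s, M < ν (t i)) : M < ν (∑ i ∈ s, t i) := by
  classical
  induction s using Finset.induction_on with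
  | empty => simpa [h.map_zero, lt_top_iff_ne_top] using hM
  | insert i s hi ih =>
    rw [Finset.sum_insert hi]
    exact h.lt_map_add (ht i (by simp)) (ih fun j hj => ht j (by simp [hj]))

/-- If the nonzero terms of a finite sum have pairwise distinct valuations, each term has
valuation at least that of the sum. -/
lemma map_sum_le_of_distinct (h : IsLocalValuation K ν e q) {ι : Type*} [Fintype ι] (t : ι → K)
    (ht : ∀ i j, t i ≠ 0 → ν (t i) = ν (t j) → i = j) (i : ι) : ν (∑ j, t j) ≤ ν (t i) := by
  classical
  obtain ⟨i₀, -, h₀⟩ := Finset.exists_min_image Finset.univ (fun j => ν (t j)) ⟨i, by simp⟩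
  refine le_trans ?_ (h₀ i (by simp))
  by_contra! hlt
  have hne : t i₀ ≠ 0 := by
    intro h0
    rw [h0, h.map_zero] at hlt
    exact not_top_lt hlt
  have hother : ν (t i₀) < ν (∑ j ∈ Finset.univ.erase i₀, t j) := by
    refine h.lt_map_sum _ _ hlt.ne_top fun j hj => lt_of_le_of_ne (h₀ j (by simp)) fun hj' => ?_
    exact (Finset.ne_of_mem_erase hj) (ht i₀ j hne hj').symm
  have := h.lt_map_sub hlt hother
  rw [← Finset.add_sum_erase _ t (Finset.mem_univ i₀), add_sub_cancel_right] at this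
  exact lt_irrefl _ this

/-- The valuation ring of `ν`. -/
def valuationSubring (h : IsLocalValuation K ν e q) : ValuationSubring K where
  carrier := {x | 0 ≤ ν x}
  mul_mem' {x y} hx hy := by
    rw [Set.mem_ofPred_eq, h.map_mul]
    exact add_nonneg hx hy
  one_mem' := h.map_one.ge
  add_mem' hx hy := h.le_map_add hx hy
  zero_mem' := by simp [h.map_zero]
  neg_mem' {x} hx := by simpa [h.map_neg] using hx
  mem_or_inv_mem' x := by
    rcases eq_or_ne x 0 with rfl | hx
    · simp [h.map_zero]
    obtain ⟨r, hr⟩ := h.exists_real hx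
    rcases le_total 0 r with h0 | h0
    · exact Or.inl (by simpa [hr] using h0)
    · refine Or.inr ?_
      rw [Set.mem_ofPred_eq, h.map_inv hr]
      exact_mod_cast neg_nonneg.2 h0

lemma mem_valuationSubring (h : IsLocalValuation K ν e q) {x : K} :
    x ∈ h.valuationSubring ↔ 0 ≤ ν x := Iff.rfl

lemma isUnit_iff (h : IsLocalValuation K ν e q) (x : h.valuationSubring) :
    IsUnit x ↔ ν (x : K) = 0 := by
  constructor
  · rintro ⟨u, rfl⟩
    have h1 : (0 : EReal) ≤ ν ((u : h.valuationSubring) : K) := (u : h.valuationSubring).2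
    have h2 : (0 : EReal) ≤ ν ((↑u⁻¹ : h.valuationSubring) : K) := (↑u⁻¹ : h.valuationSubring).2
    have h3 := h.map_mul ((u : h.valuationSubring) : K) ((↑u⁻¹ : h.valuationSubring) : K)
    have h4 : ((u : h.valuationSubring) : K) * ((↑u⁻¹ : h.valuationSubring) : K) = 1 := by
      rw [← MulMemClass.coe_mul, Units.mul_inv, OneMemClass.coe_one]
    rw [h4, h.map_one] at h3
    exact le_antisymm (h3 ▸ le_add_of_nonneg_right h2) h1
  · intro hx
    have hx' : ν (x : K) = ((0 : ℝ) : EReal) := hx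
    have hinv : (x : K)⁻¹ ∈ h.valuationSubring := by
      rw [mem_valuationSubring, h.map_inv hx']
      simp
    exact IsUnit.of_mul_eq_one ⟨_, hinv⟩
      (Subtype.ext (mul_inv_cancel₀ (h.ne_zero_of_eq_coe hx')))

lemma mem_maximalIdeal (h : IsLocalValuation K ν e q) (x : h.valuationSubring) :
    x ∈ maximalIdeal h.valuationSubring ↔ 0 < ν (x : K) := by
  rw [IsLocalRing.mem_maximalIdeal, mem_nonunits_iff, h.isUnit_iff]
  exact ⟨fun hx => lt_of_le_of_ne x.2 (Ne.symm hx), fun hx => hx.ne'⟩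

lemma residue_eq_iff (h : IsLocalValuation K ν e q) (x y : h.valuationSubring) :
    IsLocalRing.residue h.valuationSubring x = IsLocalRing.residue h.valuationSubring y ↔ 0 < ν ((x : K) - y) := by
  rw [← sub_eq_zero, ← RingHom.map_sub, residue_eq_zero_iff, h.mem_maximalIdeal]
  rfl

lemma card_residueField (h : IsLocalValuation K ν e q) :
    Nat.card (ResidueField h.valuationSubring) = q := by
  obtain ⟨s, hs, hs0, hs1⟩ := h.residue
  refine Eq.trans (Nat.card_eq_of_bijective
    (fun y : s => IsLocalRing.residue h.valuationSubring ⟨y, hs0 _ y.2⟩) ⟨fun y z hyz => ?_, fun x => ?_⟩).symm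
    (by simpa using hs)
  · rw [h.residue_eq_iff] at hyz
    obtain ⟨w, -, hw⟩ := hs1 y (hs0 _ y.2)
    refine Subtype.ext ((hw y ⟨y.2, by simp [h.map_zero]⟩).trans (hw z ⟨z.2, hyz⟩).symm)
  · obtain ⟨x, rfl⟩ := residue_surjective x
    obtain ⟨y, ⟨hy, hxy⟩, -⟩ := hs1 x x.2
    refine ⟨⟨y, hy⟩, ?_⟩
    rw [h.residue_eq_iff]
    simpa [h.map_sub_swap] using hxy

lemma finite_residueField (h : IsLocalValuation K ν e q) :
    Finite (ResidueField h.valuationSubring) := by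
  refine Nat.finite_of_card_ne_zero ?_
  rw [h.card_residueField]
  exact (zero_lt_one.trans h.one_lt_q).ne'

lemma mem_maximalIdeal_pow (h : IsLocalValuation K ν e q) (n : ℕ) (x : h.valuationSubring) :
    x ∈ maximalIdeal h.valuationSubring ^ n ↔ ((n / e : ℝ) : EReal) ≤ ν (x : K) := by
  have he : (0 : ℝ) < e := Nat.cast_pos.2 h.e_pos
  obtain ⟨π, hπ⟩ := h.exists_uniformizer
  have key (n : ℕ) (x : h.valuationSubring) : x ∈ Ideal.span
      {(⟨π, by rw [mem_valuationSubring, hπ]; exact_mod_cast (inv_pos.2 he).le⟩ :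
        h.valuationSubring) ^ n} ↔ ((n / e : ℝ) : EReal) ≤ ν (x : K) := by
    rw [Ideal.mem_span_singleton]
    have hπn := h.map_pow hπ n
    rw [← div_eq_mul_inv] at hπn
    constructor
    · rintro ⟨y, rfl⟩
      rw [MulMemClass.coe_mul, SubmonoidClass.coe_pow, h.map_mul, hπn]
      exact le_add_of_nonneg_right y.2
    · intro hx
      have hy : π⁻¹ ^ n * x ∈ h.valuationSubring := by
        rw [mem_valuationSubring, h.map_mul, inv_pow, h.map_inv hπn]
        refine le_trans ?_ (add_le_add_right hx _)
        rw [← EReal.coe_add]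
        simp
      refine ⟨⟨_, hy⟩, Subtype.ext ?_⟩
      simp [mul_inv_cancel_left₀ (pow_ne_zero n (h.ne_zero_of_eq_coe hπ))]
  have h1 : maximalIdeal h.valuationSubring = Ideal.span
      {(⟨π, by rw [mem_valuationSubring, hπ]; exact_mod_cast (inv_pos.2 he).le⟩ :
        h.valuationSubring)} := by
    ext x
    rw [h.mem_maximalIdeal, ← pow_one (Subtype.mk π _), key, Nat.cast_one]
    rcases eq_or_ne (x : K) 0 with hx | hx
    · simp [hx, h.map_zero]
    obtain ⟨m, hm⟩ := h.values x hx
    rw [hm, EReal.coe_le_coe_iff, EReal.coe_pos, div_le_div_iff_of_pos_right he, div_pos_iff_of_pos_right he]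
    norm_cast
  rw [h1, Ideal.span_singleton_pow, key]

lemma isAdicComplete (h : IsLocalValuation K ν e q) :
    IsAdicComplete (maximalIdeal h.valuationSubring) h.valuationSubring where
  haus' x hx := by
    by_contra hne
    have he : (0 : ℝ) < e := Nat.cast_pos.2 h.e_pos
    obtain ⟨r, hr⟩ := h.exists_real (fun h0 => hne (Subtype.ext h0) : (x : K) ≠ 0)
    obtain ⟨n, hn⟩ := exists_nat_gt (r * e)
    have := hx n
    rw [smul_eq_mul, Ideal.mul_top, SModEq.zero, h.mem_maximalIdeal_pow, hr,
      EReal.coe_le_coe_iff, div_le_iff₀ he] at this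
    linarith
  prec' x hx := by
    have he : (0 : ℝ) < e := Nat.cast_pos.2 h.e_pos
    have hx' {m n : ℕ} (hmn : m ≤ n) : ((m / e : ℝ) : EReal) ≤ ν ((x m : K) - x n) := by
      have := hx hmn
      rwa [smul_eq_mul, Ideal.mul_top, SModEq.sub_mem, h.mem_maximalIdeal_pow] at this
    have hle (M : ℝ) : ∃ N : ℕ, M ≤ N / e := by
      obtain ⟨N, hN⟩ := exists_nat_ge (M * e)
      exact ⟨N, (le_div_iff₀ he).2 hN⟩
    obtain ⟨l, hl⟩ := h.complete (fun n => x n) fun M => by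
      obtain ⟨N, hN⟩ := hle M
      refine ⟨N, fun m hm n hn => ?_⟩
      have h1 (m) (hm : m ≥ N) : (M : EReal) ≤ ν ((x N : K) - x m) :=
        (EReal.coe_le_coe_iff.2 hN).trans (hx' hm)
      have := h.le_map_sub (h1 n hn) (h1 m hm)
      rwa [sub_sub_sub_cancel_left] at this
    have hlx (n : ℕ) : ((n / e : ℝ) : EReal) ≤ ν ((x n : K) - l) := by
      obtain ⟨N, hN⟩ := hl (n / e)
      have := h.le_map_add (hx' (le_max_left n N)) (hN _ (le_max_right n N))
      rwa [sub_add_sub_cancel] at this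
    have hl0 : 0 ≤ ν l := by
      have := h.le_map_sub (x 0).2 ((by simpa using hlx 0) : 0 ≤ ν ((x 0 : K) - l))
      rwa [sub_sub_cancel] at this
    refine ⟨⟨l, hl0⟩, fun n => ?_⟩
    rw [smul_eq_mul, Ideal.mul_top, SModEq.sub_mem, h.mem_maximalIdeal_pow]
    exact hlx n

lemma henselianLocalRing (h : IsLocalValuation K ν e q) :
    HenselianLocalRing h.valuationSubring where
  is_henselian f hf a₀ h₁ h₂ := by
    have := h.isAdicComplete
    exact HenselianRing.is_henselian f hf a₀ h₁ (h₂.map _)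

end Field
end IsLocalValuation

section HenselianLocalRing

open IsLocalRing Polynomial

lemma HenselianLocalRing.exists_pow_eq {R : Type*} [CommRing R] [HenselianLocalRing R] {n : ℕ}
    (hn : (n : ResidueField R) ≠ 0) {x : R} (hx : residue R x = 1) : ∃ y : R, y ^ n = x := by
  have hn0 : n ≠ 0 := by
    rintro rfl
    simp at hn
  obtain ⟨y, hy, -⟩ := HenselianLocalRing.is_henselian (X ^ n - C x : R[X])
    (monic_X_pow_sub_C x hn0) 1
    (by rw [← residue_eq_zero_iff]; simp [hx])
    (by
      rw [derivative_sub, derivative_C, sub_zero, derivative_X_pow, eval_mul, eval_C, eval_pow,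
        eval_X, one_pow, mul_one, ← residue_ne_zero_iff_isUnit, map_natCast]
      exact hn)
  exact ⟨y, by simpa [sub_eq_zero] using hy⟩

/-- A generator of the residue field extension lifts to a root of a monic polynomial whose
degree is the residue degree. -/
lemma HenselianLocalRing.exists_lift_generator (R : Type*) {S : Type*} [CommRing R]
    [IsLocalRing R] [CommRing S] [HenselianLocalRing S] [Algebra R S]
    [IsLocalHom (algebraMap R S)] [Finite (ResidueField S)] :
    ∃ (g : R[X]) (z : S), g.Monic ∧
      g.natDegree = Module.finrank (ResidueField R) (ResidueField S) ∧ aeval z g = 0 ∧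
      LinearIndependent (ResidueField R)
        fun i : Fin (Module.finrank (ResidueField R) (ResidueField S)) => residue S z ^ (i : ℕ) := by
  have : Finite (ResidueField R) :=
    Finite.of_injective _ (algebraMap (ResidueField R) (ResidueField S)).injective
  let pb := Field.powerBasisOfFiniteOfSeparable (ResidueField R) (ResidueField S)
  have hint := pb.isIntegral_gen
  have hsep : (minpoly (ResidueField R) pb.gen).Separable :=
    Algebra.IsSeparable.isSeparable (ResidueField R) pb.gen
  obtain ⟨g, hg, hgd, hgm⟩ := lifts_and_natDegree_eq_and_monic
    (f := residue R) (p := minpoly (ResidueField R) pb.gen)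
    (by
      rw [lifts_iff_ringHom_rangeS, RingHom.mem_rangeS]
      exact map_surjective _ residue_surjective _) (minpoly.monic hint)
  obtain ⟨z₀, hz₀⟩ := residue_surjective (R := S) pb.gen
  have hcomp : (residue S).comp (algebraMap R S) =
      (algebraMap (ResidueField R) (ResidueField S)).comp (residue R) := rfl
  have hres (r : R[X]) : residue S (eval z₀ (r.map (algebraMap R S))) =
      aeval pb.gen (r.map (residue R)) := by
    rw [← eval₂_at_apply, ← eval_map, Polynomial.map_map, hcomp, hz₀, ← Polynomial.map_map,
      aeval_def, eval_map]
  obtain ⟨z, hz, hzz₀⟩ := HenselianLocalRing.is_henselian (g.map (algebraMap R S))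
    (hgm.map _) z₀ (by rw [← residue_eq_zero_iff, hres, hg, minpoly.aeval]) (by
      rw [← residue_ne_zero_iff_isUnit, derivative_map, hres, ← derivative_map, hg]
      exact hsep.aeval_derivative_ne_zero (minpoly.aeval _ _))
  have hzr : residue S z = pb.gen := by
    rw [← hz₀, ← sub_eq_zero, ← map_sub, residue_eq_zero_iff]
    exact hzz₀
  have hdim : pb.dim = Module.finrank (ResidueField R) (ResidueField S) := pb.finrank.symm
  refine ⟨g, z, hgm, ?_, ?_, ?_⟩
  · rw [hgd, pb.natDegree_minpoly, hdim]
  · simpa [aeval_def, eval_map] using hz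
  · rw [← hdim, hzr, ← pb.coe_basis]
    exact pb.basis.linearIndependent

end HenselianLocalRing

section FiniteField

/-- In an extension of finite fields of cardinalities `q` and `N + 1`, an element killed by
`N / gcd (N / (q - 1)) e` is an `e`-th power times a nonzero element of the base field. -/
lemma FiniteField.exists_eq_pow_mul_algebraMap {F K : Type*} [Field F] [Field K] [Algebra F K]
    [Finite F] [Finite K] (e : ℕ) (he : 0 < e)
    (hdvd : Nat.card F - 1 ∣ Nat.card K - 1) {x : K} (hx0 : x ≠ 0)
    (hx : x ^ ((Nat.card K - 1) / Nat.gcd ((Nat.card K - 1) / (Nat.card F - 1)) e) = 1) :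
    ∃ (u : K) (w : F), x = u ^ e * algebraMap F K w := by
  have := Fintype.ofFinite F
  have := Fintype.ofFinite K
  obtain ⟨M, hM⟩ := hdvd
  have hF : 0 < Nat.card F - 1 := Nat.sub_pos_of_lt Finite.one_lt_card
  have hK : 0 < Nat.card K - 1 := Nat.sub_pos_of_lt Finite.one_lt_card
  have hcard : Nat.card Kˣ = Nat.card K - 1 := Nat.card_units K
  rw [hM, Nat.mul_div_cancel_left _ hF] at hx
  set d := Nat.gcd M e with hd
  have hd0 : 0 < d := Nat.gcd_pos_of_pos_right _ he
  obtain ⟨M', hM'⟩ : d ∣ M := Nat.gcd_dvd_left M e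
  obtain ⟨g, hg⟩ := IsCyclic.exists_generator (α := Kˣ)
  obtain ⟨m, hm⟩ := Subgroup.mem_zpowers_iff.1 (hg (Units.mk0 x hx0))
  have hord : orderOf g = d * ((Nat.card F - 1) * M') := by
    rw [orderOf_eq_card_of_forall_mem_zpowers hg, hcard, hM]
    conv_lhs => rw [hM']
    ring
  have hM'0 : 0 < (Nat.card F - 1) * M' := by
    refine Nat.pos_of_ne_zero fun h => ?_
    rw [h, mul_zero, orderOf_eq_card_of_forall_mem_zpowers hg, hcard] at hord
    omega
  have hexp : (Nat.card F - 1) * M / d = (Nat.card F - 1) * M' := by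
    conv_lhs => rw [hM']
    rw [mul_left_comm, Nat.mul_div_cancel_left _ hd0]
  rw [hexp] at hx
  have hdm : (d : ℤ) ∣ m := by
    have h1 : g ^ (m * ((Nat.card F - 1) * M' : ℕ)) = 1 := by
      rw [zpow_mul, hm, zpow_natCast]
      exact Units.ext (by simpa using hx)
    rw [← orderOf_dvd_iff_zpow_eq_one, hord, Nat.cast_mul] at h1
    exact Int.dvd_of_mul_dvd_mul_right (by exact_mod_cast hM'0.ne') h1
  obtain ⟨n, rfl⟩ := hdm
  rw [hd, Nat.gcd_eq_gcd_ab] at hm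
  set z : Kˣ := g ^ (M * (Nat.gcdA M e * n)) with hz
  have hzF : z ^ (Nat.card F - 1) = 1 := by
    rw [hz, ← zpow_natCast, ← zpow_mul, ← orderOf_dvd_iff_zpow_eq_one,
      orderOf_eq_card_of_forall_mem_zpowers hg, hcard, hM]
    exact ⟨Nat.gcdA M e * n, by push_cast; ring⟩
  have hzq : (z : K) ^ Fintype.card F = z := by
    rw [← Nat.card_eq_fintype_card, ← Nat.sub_add_cancel (Nat.card_pos (α := F)), pow_succ,
      ← Units.val_pow_eq_pow_val, hzF, Units.val_one, one_mul]
  obtain ⟨w, hw⟩ : ∃ w : F, algebraMap F K w = z := by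
    have hprod := Polynomial.prod_multiset_X_sub_C_of_monic_of_roots_card_eq
      (p := (Polynomial.X ^ Fintype.card F - Polynomial.X : Polynomial F))
      (Polynomial.monic_X_pow_sub (by
        rw [Polynomial.degree_X]; exact_mod_cast Fintype.one_lt_card))
      (by rw [FiniteField.roots_X_pow_card_sub_X,
        FiniteField.X_pow_card_sub_X_natDegree_eq F Fintype.one_lt_card]; rfl)
    rw [FiniteField.roots_X_pow_card_sub_X] at hprod
    have h0 := congrArg (Polynomial.aeval (z : K)) hprod
    rw [map_sub, map_pow, Polynomial.aeval_X, hzq, sub_self, map_multiset_prod,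
      Multiset.prod_eq_zero_iff] at h0
    simp only [Multiset.map_map, Multiset.mem_map] at h0
    obtain ⟨w, -, hw⟩ := h0
    exact ⟨w, (sub_eq_zero.1 (by simpa using hw)).symm⟩
  refine ⟨((g ^ (Nat.gcdB M e * n) : Kˣ) : K), w, ?_⟩
  rw [hw, ← Units.val_pow_eq_pow_val, ← Units.val_mul, hz, ← zpow_natCast, ← zpow_mul, ← zpow_add]
  have := congrArg Units.val hm
  rw [Units.val_mk0] at this
  rw [← this]
  congr 2
  ring

end FiniteField

namespace IsLocalValuation

open IsLocalRing Polynomial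

section Field

variable {K : Type*} [Field K] {ν : K → EReal} {e q : ℕ}

lemma le_map_sum (h : IsLocalValuation K ν e q) {ι : Type*} (s : Finset ι) (t : ι → K)
    {M : EReal} (ht : ∀ i ∈ s, M ≤ ν (t i)) : M ≤ ν (∑ i ∈ s, t i) := by
  classical
  induction s using Finset.induction_on with
  | empty => simp [h.map_zero]
  | insert i s hi ih =>
    rw [Finset.sum_insert hi]
    exact h.le_map_add (ht i (by simp)) (ih fun j hj => ht j (by simp [hj]))

lemma map_pow_eq_zero (h : IsLocalValuation K ν e q) {x : K} (hx : ν x = 0) (n : ℕ) :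
    ν (x ^ n) = 0 := by
  simpa using h.map_pow (r := 0) hx n

lemma sub_one_pos_mul (h : IsLocalValuation K ν e q) {x y : K} (hx : 0 < ν (x - 1))
    (hy : 0 < ν (y - 1)) : 0 < ν (x * y - 1) := by
  have hx0 : 0 ≤ ν x := by
    have := h.le_map_add hx.le h.map_one.ge
    rwa [sub_add_cancel] at this
  rw [show x * y - 1 = x * (y - 1) + (x - 1) by ring]
  refine h.lt_map_add ?_ hx
  rw [h.map_mul]
  exact hy.trans_le (le_add_of_nonneg_left hx0)

lemma sub_one_pos_pow (h : IsLocalValuation K ν e q) {x : K} (hx : 0 < ν (x - 1)) (n : ℕ) :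
    0 < ν (x ^ n - 1) := by
  induction n with
  | zero => simp [h.map_zero]
  | succ n ih =>
    rw [pow_succ]
    exact h.sub_one_pos_mul ih hx

lemma pow_card_sub_one (h : IsLocalValuation K ν e q) {x : K} (hx : ν x = 0) :
    0 < ν (x ^ (q - 1) - 1) := by
  have := h.finite_residueField
  have := Fintype.ofFinite (ResidueField h.valuationSubring)
  have hx0 : x ∈ h.valuationSubring := hx.ge
  have hne : IsLocalRing.residue h.valuationSubring ⟨x, hx0⟩ ≠ 0 := by
    rw [residue_ne_zero_iff_isUnit, h.isUnit_iff]
    exact hx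
  have h1 := FiniteField.pow_card_sub_one_eq_one _ hne
  rw [← Nat.card_eq_fintype_card, h.card_residueField, ← _root_.map_pow,
    ← (IsLocalRing.residue h.valuationSubring).map_one, h.residue_eq_iff] at h1
  exact h1

lemma exists_pow_eq (h : IsLocalValuation K ν e q) {n : ℕ}
    (hn : (n : ResidueField h.valuationSubring) ≠ 0) {x : K} (hx : 0 < ν (x - 1)) :
    ∃ y, y ^ n = x := by
  have := h.henselianLocalRing
  have hx0 : x ∈ h.valuationSubring := by
    have := h.le_map_add hx.le h.map_one.ge
    rwa [sub_add_cancel] at this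
  obtain ⟨y, hy⟩ := HenselianLocalRing.exists_pow_eq hn (x := ⟨x, hx0⟩) (by
    rw [← (IsLocalRing.residue h.valuationSubring).map_one, h.residue_eq_iff]
    exact hx)
  exact ⟨y, congrArg Subtype.val hy⟩

lemma natCast_residueField_ne_zero (h : IsLocalValuation K ν e q) {n p a : ℕ}
    (hq : q = p ^ a) (hn : n.Coprime p) : (n : ResidueField h.valuationSubring) ≠ 0 := by
  have := h.finite_residueField
  have := Fintype.ofFinite (ResidueField h.valuationSubring)
  have hp0 : (p : ResidueField h.valuationSubring) = 0 := by
    have h1 : ((Nat.card (ResidueField h.valuationSubring) : ℕ) :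
        ResidueField h.valuationSubring) = 0 := by
      rw [Nat.card_eq_fintype_card, FiniteField.cast_card_eq_zero]
    rw [h.card_residueField] at h1
    replace h1 := (congrArg (Nat.cast : ℕ → ResidueField h.valuationSubring) hq).symm.trans h1
    rw [Nat.cast_pow] at h1
    exact eq_zero_of_pow_eq_zero h1
  intro hn0
  have h2 := congrArg (Int.cast : ℤ → ResidueField h.valuationSubring) (Nat.gcd_eq_gcd_ab n p)
  rw [Nat.Coprime.gcd_eq_one hn] at h2
  simp [hp0, hn0] at h2

/-- If the coefficients `b j` have integral valuations and `π` is a uniformizer, the terms of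
`∑ b j * π ^ j` have valuation at least that of the sum. -/
lemma map_sum_mul_pow_le (h : IsLocalValuation K ν e q) {π : K}
    (hπ : ν π = (((e : ℝ)⁻¹ : ℝ) : EReal)) (b : Fin e → K)
    (hb : ∀ j, b j ≠ 0 → ∃ m : ℤ, ν (b j) = ((m : ℝ) : EReal)) (j : Fin e) :
    ν (∑ i, b i * π ^ (i : ℕ)) ≤ ν (b j * π ^ (j : ℕ)) := by
  have he : (e : ℝ) ≠ 0 := Nat.cast_ne_zero.2 h.e_pos.ne'
  have hπ0 := h.ne_zero_of_eq_coe hπ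
  refine h.map_sum_le_of_distinct _ (fun i j hi hij => ?_) j
  obtain ⟨m, hm⟩ := hb i (left_ne_zero_of_mul hi)
  have hj : b j ≠ 0 := by
    intro hj
    rw [hj, zero_mul, h.map_zero, h.eq_top_iff] at hij
    exact hi hij
  obtain ⟨n, hn⟩ := hb j hj
  rw [h.map_mul_coe hm (h.map_pow hπ _), h.map_mul_coe hn (h.map_pow hπ _),
    EReal.coe_eq_coe_iff] at hij
  field_simp at hij
  rw [mul_comm (m : ℝ)] at hij
  have hij' : (e : ℤ) * m + (i : ℕ) = e * n + (j : ℕ) := by exact_mod_cast hij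
  have := congrArg (· % (e : ℤ)) hij'
  simp only [Int.mul_add_emod_self_left] at this
  rw [Int.emod_eq_of_lt (by omega) (by omega), Int.emod_eq_of_lt (by omega) (by omega)] at this
  exact Fin.ext (by exact_mod_cast this)

end Field

section Extension

variable {k E : Type*} [Field k] [Field E] [Algebra k E] {νk : k → EReal} {νE : E → EReal}
  {e f q qE : ℕ}

lemma exists_int (hk : IsLocalValuation k νk 1 q) {x : k} (hx : x ≠ 0) :
    ∃ m : ℤ, νk x = ((m : ℝ) : EReal) := by
  obtain ⟨m, hm⟩ := hk.values x hx
  exact ⟨m, by simpa using hm⟩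

/-- The inclusion of valuation rings in an extension of valued fields. -/
def ringHom (hk : IsLocalValuation k νk 1 q) (hE : IsLocalValuation E νE e qE)
    (hcompat : ∀ c : k, νE (algebraMap k E c) = νk c) :
    hk.valuationSubring →+* hE.valuationSubring :=
  (algebraMap k E).restrict _ _ fun x hx => by
    rw [mem_valuationSubring, hcompat]
    exact hx

lemma isLocalHom_ringHom (hk : IsLocalValuation k νk 1 q) (hE : IsLocalValuation E νE e qE)
    (hcompat : ∀ c : k, νE (algebraMap k E c) = νk c) :
    IsLocalHom (hk.ringHom hE hcompat) where
  map_nonunit x hx := by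
    rw [isUnit_iff] at hx ⊢
    rwa [← hcompat]

/-- `E` contains a root `z` of a monic polynomial of degree `f` over `k`, whose powers `z ^ i`,
`i < f`, reduce to a basis of the residue field extension. -/
lemma exists_unramified_generator (hk : IsLocalValuation k νk 1 q)
    (hE : IsLocalValuation E νE e qE) (hcompat : ∀ c : k, νE (algebraMap k E c) = νk c)
    (hf : qE = q ^ f) :
    ∃ (g : k[X]) (z : E), g.Monic ∧ g.natDegree = f ∧ aeval z g = 0 ∧ 0 ≤ νE z ∧
      ∀ (a : Fin f → k) (i : Fin f),
        νE (∑ j, algebraMap k E (a j) * z ^ (j : ℕ)) ≤ νk (a i) := by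
  let := (hk.ringHom hE hcompat).toAlgebra
  have : IsLocalHom (algebraMap hk.valuationSubring hE.valuationSubring) :=
    hk.isLocalHom_ringHom hE hcompat
  have := hE.finite_residueField
  have := hk.finite_residueField
  have := hE.henselianLocalRing
  obtain ⟨g, z, hg, hgd, hz, hli⟩ :=
    HenselianLocalRing.exists_lift_generator hk.valuationSubring (S := hE.valuationSubring)
  obtain rfl : Module.finrank (ResidueField hk.valuationSubring)
      (ResidueField hE.valuationSubring) = f := by
    have h1 := Module.natCard_eq_pow_finrank (K := ResidueField hk.valuationSubring)
      (V := ResidueField hE.valuationSubring)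
    rw [hk.card_residueField, hE.card_residueField] at h1
    exact (Nat.pow_right_injective hk.one_lt_q (hf.symm.trans h1)).symm
  refine ⟨g.map (algebraMap hk.valuationSubring k), z, hg.map _, ?_, ?_, z.2, fun a i => ?_⟩
  · rw [hg.natDegree_map, hgd]
  · have hcomp : (algebraMap k E).comp (algebraMap hk.valuationSubring k) =
        (algebraMap hE.valuationSubring E).comp
          (algebraMap hk.valuationSubring hE.valuationSubring) := rfl
    rw [aeval_def, eval₂_map, hcomp]
    refine (hom_eval₂ g _ (algebraMap hE.valuationSubring E) z).symm.trans ?_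
    rw [← aeval_def, hz, _root_.map_zero]
  · obtain ⟨i₀, -, h₀⟩ := Finset.exists_min_image Finset.univ (fun j => νk (a j)) ⟨i, by simp⟩
    refine le_trans ?_ (h₀ i (by simp))
    by_contra! hlt
    have hc : a i₀ ≠ 0 := by
      intro h0
      rw [h0, hk.map_zero] at hlt
      exact not_top_lt hlt
    obtain ⟨r, hr⟩ := hk.exists_real hc
    have hb (j) : 0 ≤ νk (a j * (a i₀)⁻¹) := by
      rw [hk.map_mul, hk.map_inv hr]
      refine le_trans ?_ (add_le_add_left (h₀ j (by simp)) _)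
      rw [hr, ← EReal.coe_add]
      simp
    let b (j) : hk.valuationSubring := ⟨a j * (a i₀)⁻¹, hb j⟩
    have hsum : 0 < νE ((∑ j, algebraMap hk.valuationSubring hE.valuationSubring (b j) *
        z ^ (j : ℕ) : hE.valuationSubring) : E) := by
      by_contra! hle
      refine hlt.not_ge ?_
      have hcoe : ∑ j, algebraMap k E (a j) * (z : E) ^ (j : ℕ) = algebraMap k E (a i₀) *
          ((∑ j, algebraMap hk.valuationSubring hE.valuationSubring (b j) *
            z ^ (j : ℕ) : hE.valuationSubring) : E) := by
        rw [AddSubmonoidClass.coe_finsetSum, Finset.mul_sum]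
        refine Finset.sum_congr rfl fun j _ => ?_
        change _ = _ * (algebraMap k E (a j * (a i₀)⁻¹) * (z : E) ^ (j : ℕ))
        rw [← mul_assoc, ← _root_.map_mul, mul_comm (a i₀), inv_mul_cancel_right₀ hc]
      rw [hcoe, hE.map_mul, hcompat]
      exact add_le_of_nonpos_right hle
    rw [← hE.mem_maximalIdeal, ← residue_eq_zero_iff, map_sum] at hsum
    have h1 := Fintype.linearIndependent_iff.1 hli
      (fun j => IsLocalRing.residue hk.valuationSubring (b j)) (by
        rw [← hsum]
        refine Finset.sum_congr rfl fun j _ => ?_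
        rw [_root_.map_mul, _root_.map_pow, Algebra.smul_def]
        rfl) i₀
    rw [residue_eq_zero_iff, hk.mem_maximalIdeal] at h1
    change 0 < νk (a i₀ * (a i₀)⁻¹) at h1
    rw [mul_inv_cancel₀ hc, hk.map_one] at h1
    exact lt_irrefl _ h1

lemma exists_int_of_unramified (hk : IsLocalValuation k νk 1 q)
    (hE : IsLocalValuation E νE e qE) (hcompat : ∀ c : k, νE (algebraMap k E c) = νk c)
    {z : E} (hz0 : 0 ≤ νE z) (hz : ∀ (a : Fin f → k) (i : Fin f),
      νE (∑ j, algebraMap k E (a j) * z ^ (j : ℕ)) ≤ νk (a i)) (a : Fin f → k)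
    (ha : ∑ j, algebraMap k E (a j) * z ^ (j : ℕ) ≠ 0) :
    ∃ m : ℤ, νE (∑ j, algebraMap k E (a j) * z ^ (j : ℕ)) = ((m : ℝ) : EReal) := by
  have hne : (Finset.univ : Finset (Fin f)).Nonempty := by
    by_contra hne
    rw [Finset.not_nonempty_iff_eq_empty] at hne
    simp [hne] at ha
  obtain ⟨i, -, hi⟩ := Finset.exists_min_image Finset.univ (fun j => νk (a j)) hne
  have heq : νE (∑ j, algebraMap k E (a j) * z ^ (j : ℕ)) = νk (a i) := by
    refine le_antisymm (hz a i) (hE.le_map_sum _ _ fun j _ => ?_)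
    rw [hE.map_mul, hcompat]
    exact (hi j (by simp)).trans (le_add_of_nonneg_right (pow_mem (S := hE.valuationSubring) hz0 j))
  rw [heq]
  refine hk.exists_int fun h0 => ha ?_
  rw [← hE.eq_top_iff, heq, h0, hk.map_zero]

lemma linearIndependent_mul_pow (hk : IsLocalValuation k νk 1 q)
    (hE : IsLocalValuation E νE e qE) (hcompat : ∀ c : k, νE (algebraMap k E c) = νk c)
    {z π : E} (hz0 : 0 ≤ νE z) (hz : ∀ (a : Fin f → k) (i : Fin f),
      νE (∑ j, algebraMap k E (a j) * z ^ (j : ℕ)) ≤ νk (a i))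
    (hπ : νE π = (((e : ℝ)⁻¹ : ℝ) : EReal)) :
    LinearIndependent k fun x : Fin f × Fin e => z ^ (x.1 : ℕ) * π ^ (x.2 : ℕ) := by
  rw [Fintype.linearIndependent_iff]
  rintro a ha ⟨i, j⟩
  have hsum : ∑ j, (∑ i, algebraMap k E (a (i, j)) * z ^ (i : ℕ)) * π ^ (j : ℕ) = 0 := by
    rw [← ha, Fintype.sum_prod_type_right]
    refine Finset.sum_congr rfl fun j _ => ?_
    rw [Finset.sum_mul]
    refine Finset.sum_congr rfl fun i _ => ?_
    rw [Algebra.smul_def, mul_assoc]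
  have h1 := hE.map_sum_mul_pow_le hπ _ (fun j => hk.exists_int_of_unramified hE hcompat hz0 hz
    (fun i => a (i, j))) j
  rw [hsum, hE.map_zero, top_le_iff, hE.eq_top_iff, mul_eq_zero,
    or_iff_left (pow_ne_zero _ (hE.ne_zero_of_eq_coe hπ))] at h1
  have h2 := hz (fun i => a (i, j)) i
  rw [h1, hE.map_zero, top_le_iff, hk.eq_top_iff] at h2
  exact h2

lemma span_mul_pow_eq_top (hk : IsLocalValuation k νk 1 q)
    (hE : IsLocalValuation E νE e qE) (hcompat : ∀ c : k, νE (algebraMap k E c) = νk c)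
    [FiniteDimensional k E] (hdeg : Module.finrank k E = e * f)
    {z π : E} (hz0 : 0 ≤ νE z) (hz : ∀ (a : Fin f → k) (i : Fin f),
      νE (∑ j, algebraMap k E (a j) * z ^ (j : ℕ)) ≤ νk (a i))
    (hπ : νE π = (((e : ℝ)⁻¹ : ℝ) : EReal)) :
    Submodule.span k (Set.range fun x : Fin f × Fin e => z ^ (x.1 : ℕ) * π ^ (x.2 : ℕ)) = ⊤ :=
  (hk.linearIndependent_mul_pow hE hcompat hz0 hz hπ).span_eq_top_of_card_eq_finrank'
    (by simp [hdeg, mul_comm])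

/-- An intermediate field with integral valuations has degree at most the residue degree. -/
lemma finrank_le_of_forall_exists_int (hk : IsLocalValuation k νk 1 q)
    (hE : IsLocalValuation E νE e qE) (hcompat : ∀ c : k, νE (algebraMap k E c) = νk c)
    [FiniteDimensional k E] (hdeg : Module.finrank k E = e * f) (hf : qE = q ^ f)
    (L : IntermediateField k E)
    (hL : ∀ x : L, (x : E) ≠ 0 → ∃ m : ℤ, νE (x : E) = ((m : ℝ) : EReal)) :
    Module.finrank k L ≤ f := by
  obtain ⟨g, z, -, -, -, hz0, hz⟩ := hk.exists_unramified_generator hE hcompat hf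
  obtain ⟨π, hπ⟩ := hE.exists_uniformizer
  let B := Module.Basis.mk (hk.linearIndependent_mul_pow hE hcompat hz0 hz hπ)
    (hk.span_mul_pow_eq_top hE hcompat hdeg hz0 hz hπ).ge
  let j₀ : Fin e := ⟨0, hE.e_pos⟩
  let φ : L →ₗ[k] (Fin f → k) :=
    LinearMap.pi fun i => (B.coord (i, j₀)).comp L.val.toLinearMap
  have hφ : Function.Injective φ := by
    rw [injective_iff_map_eq_zero]
    intro x hx
    have hx0 (i) : B.repr (x : E) (i, j₀) = 0 := congrFun hx i
    let c (j : Fin e) : E := ∑ i, algebraMap k E (B.repr (x : E) (i, j)) * z ^ (i : ℕ)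
    have hc0 : c j₀ = 0 := by simp [c, hx0]
    have hxc : ∑ j, c j * π ^ (j : ℕ) = x := by
      conv_rhs => rw [← B.sum_repr (x : E)]
      rw [Fintype.sum_prod_type_right]
      refine Finset.sum_congr rfl fun j _ => ?_
      rw [Finset.sum_mul]
      refine Finset.sum_congr rfl fun i _ => ?_
      rw [Module.Basis.mk_apply, Algebra.smul_def, mul_assoc]
    have hsum : ∑ j, (c j - if j = j₀ then (x : E) else 0) * π ^ (j : ℕ) = 0 := by
      simp [sub_mul, hxc, ite_mul, j₀]
    have := hE.map_sum_mul_pow_le hπ (fun j => c j - if j = j₀ then (x : E) else 0) (fun j hj => by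
      by_cases hjj : j = j₀
      · have hxne : (x : E) ≠ 0 := by simpa [hjj, hc0] using hj
        simpa [hjj, hc0, hE.map_neg] using hL x hxne
      · simp only [hjj, if_false, sub_zero] at hj ⊢
        exact hk.exists_int_of_unramified hE hcompat hz0 hz _ hj) j₀
    rw [hsum, hE.map_zero, top_le_iff, hE.eq_top_iff] at this
    simpa [hc0, j₀] using this
  simpa using LinearMap.finrank_le_finrank_of_injective hφ

lemma finrank_adjoin_simple_le [FiniteDimensional k E] {x : E} {g : k[X]} (hg : g ≠ 0)
    (hx : aeval x g = 0) : Module.finrank k (IntermediateField.adjoin k {x}) ≤ g.natDegree := by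
  rw [IntermediateField.adjoin.finrank (Algebra.IsIntegral.isIntegral x)]
  exact natDegree_le_of_dvd (minpoly.dvd k x hx) hg

lemma map_root (hk : IsLocalValuation k νk 1 q)
    (hE : IsLocalValuation E νE e qE) (hcompat : ∀ c : k, νE (algebraMap k E c) = νk c)
    {πk : k} {α : E} (hπk : νk πk = (1 : EReal)) (hα : α ^ e = algebraMap k E πk) :
    νE α = (((e : ℝ)⁻¹ : ℝ) : EReal) := by
  have hπk' : νk πk = ((1 : ℝ) : EReal) := hπk
  have hα0 : α ≠ 0 := by
    rintro rfl
    rw [zero_pow hE.e_pos.ne'] at hα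
    exact hk.ne_zero_of_eq_coe hπk' ((map_eq_zero _).1 hα.symm)
  obtain ⟨r, hr⟩ := hE.exists_real hα0
  have h1 := hE.map_pow hr e
  rw [hα, hcompat, hπk', EReal.coe_eq_coe_iff] at h1
  rw [hr, eq_inv_of_mul_eq_one_right h1.symm]

lemma exists_tensor_decomposition (hk : IsLocalValuation k νk 1 q)
    (hE : IsLocalValuation E νE e qE) (hcompat : ∀ c : k, νE (algebraMap k E c) = νk c)
    [FiniteDimensional k E] (hdeg : Module.finrank k E = e * f) (hf : qE = q ^ f)
    {πk : k} {α : E} (hπk : νk πk = (1 : EReal)) (hα : α ^ e = algebraMap k E πk) :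
    ∃ T L : IntermediateField k E,
      (∃ π : T, νE (π : E) = (((Module.finrank k T : ℝ)⁻¹ : ℝ) : EReal)) ∧
      (∀ x : L, (x : E) ≠ 0 → ∃ m : ℤ, νE (x : E) = ((m : ℝ) : EReal)) ∧
      Module.finrank k T * Module.finrank k L = Module.finrank k E ∧ T ⊔ L = ⊤ := by
  have hαν := hk.map_root hE hcompat hπk hα
  obtain ⟨g, z, hg, hgd, hgz, hz0, hz⟩ := hk.exists_unramified_generator hE hcompat hf
  let T := IntermediateField.adjoin k {α}
  let L := IntermediateField.adjoin k {z}
  have hαT : α ∈ T := IntermediateField.mem_adjoin_simple_self k α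
  have hzL : z ∈ L := IntermediateField.mem_adjoin_simple_self k z
  have hTL : T ⊔ L = ⊤ := by
    refine _root_.eq_top_iff.2 fun x _ => ?_
    have hx : x ∈ Submodule.span k (Set.range fun x : Fin f × Fin e =>
        z ^ (x.1 : ℕ) * α ^ (x.2 : ℕ)) := by
      rw [hk.span_mul_pow_eq_top hE hcompat hdeg hz0 hz hαν]
      trivial
    have hle : Submodule.span k (Set.range fun x : Fin f × Fin e =>
        z ^ (x.1 : ℕ) * α ^ (x.2 : ℕ)) ≤ (T ⊔ L).toSubalgebra.toSubmodule := by
      rw [Submodule.span_le]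
      rintro _ ⟨y, rfl⟩
      change z ^ (y.1 : ℕ) * α ^ (y.2 : ℕ) ∈ T ⊔ L
      exact mul_mem (pow_mem ((le_sup_right : L ≤ T ⊔ L) hzL) _)
        (pow_mem ((le_sup_left : T ≤ T ⊔ L) hαT) _)
    exact hle hx
  have hTe : Module.finrank k T ≤ e := by
    have h1 := finrank_adjoin_simple_le (X_pow_sub_C_ne_zero hE.e_pos πk)
      (x := α) (by simp [hα])
    rwa [natDegree_X_pow_sub_C] at h1
  have hLf : Module.finrank k L ≤ f := hgd ▸ finrank_adjoin_simple_le hg.ne_zero hgz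
  have hmul : e * f ≤ Module.finrank k T * Module.finrank k L := by
    rw [← hdeg, ← IntermediateField.finrank_top' (F := k) (E := E), ← hTL]
    exact IntermediateField.finrank_sup_le T L
  have hf0 : 0 < f := by
    have : 0 < e * f := hdeg ▸ Module.finrank_pos
    exact Nat.pos_of_mul_pos_left this
  have hTe' : Module.finrank k T = e :=
    le_antisymm hTe (Nat.le_of_mul_le_mul_right (hmul.trans (Nat.mul_le_mul_left _ hLf)) hf0)
  refine ⟨T, L, ⟨⟨α, hαT⟩, by rw [hTe', hαν]⟩, ?_, ?_, hTL⟩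
  · rintro ⟨x, hxL⟩ hx
    obtain ⟨a, rfl⟩ : ∃ a : Fin f → k, x = ∑ j, algebraMap k E (a j) * z ^ (j : ℕ) := by
      have h1 : x ∈ L.toSubalgebra := hxL
      rw [IntermediateField.adjoin_simple_toSubalgebra_of_isAlgebraic
        (Algebra.IsAlgebraic.isAlgebraic z), Algebra.adjoin_singleton_eq_range_aeval] at h1
      obtain ⟨r, rfl⟩ := h1
      have hlt : (r %ₘ g).natDegree < f := by
        rw [← hgd]
        exact natDegree_modByMonic_lt r hg (by rintro rfl; simp at hgd; omega)
      refine ⟨fun j => (r %ₘ g).coeff j, ?_⟩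
      change aeval z r = _
      rw [← aeval_modByMonic_eq_self_of_root hgz, aeval_eq_sum_range' hlt, Finset.sum_range]
      simp only [Algebra.smul_def]
    exact hk.exists_int_of_unramified hE hcompat hz0 hz a hx
  · rw [hdeg]
    exact le_antisymm (Nat.mul_le_mul hTe hLf) hmul

lemma exists_root_of_congr (hk : IsLocalValuation k νk 1 q)
    (hE : IsLocalValuation E νE e qE) (hcompat : ∀ c : k, νE (algebraMap k E c) = νk c)
    (he : (e : ResidueField hE.valuationSubring) ≠ 0) {πE u : E} {πk w : k}
    (hπE : νE πE = (((e : ℝ)⁻¹ : ℝ) : EReal)) (hπk : νk πk = (1 : EReal)) (hu : νE u = 0)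
    (hw : νk w = 0)
    (h : 0 < νE (πE ^ e * (algebraMap k E πk)⁻¹ - u ^ e * algebraMap k E w)) :
    ∃ (πk : k) (α : E), νk πk = (1 : EReal) ∧ α ^ e = algebraMap k E πk := by
  have hπE0 := hE.ne_zero_of_eq_coe hπE
  have hu0 : u ≠ 0 := hE.ne_zero_of_eq_coe (r := 0) hu
  have hw0 : w ≠ 0 := hk.ne_zero_of_eq_coe (r := 0) hw
  have hπk0 : πk ≠ 0 := hk.ne_zero_of_eq_coe (r := 1) hπk
  have hw0' : algebraMap k E w ≠ 0 := (_root_.map_ne_zero _).2 hw0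
  have hπk0' : algebraMap k E πk ≠ 0 := (_root_.map_ne_zero _).2 hπk0
  have huw : νE (u ^ e * algebraMap k E w)⁻¹ = 0 := by
    have h1 : νE (u ^ e * algebraMap k E w) = ((0 : ℝ) : EReal) := by
      rw [hE.map_mul, hE.map_pow_eq_zero hu, hcompat, hw, add_zero, EReal.coe_zero]
    rw [hE.map_inv h1]
    simp
  obtain ⟨v, hv⟩ := hE.exists_pow_eq he
    (x := (u ^ e * algebraMap k E w)⁻¹ * (πE ^ e * (algebraMap k E πk)⁻¹)) (by
      rw [← inv_mul_cancel₀ (mul_ne_zero (pow_ne_zero e hu0) hw0'), ← mul_sub, hE.map_mul, huw,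
        zero_add]
      exact h)
  have hv0 : v ^ e ≠ 0 := by
    rw [hv]
    simp [hu0, hw0, hπE0, hπk0]
  refine ⟨πk * w, πE * (u * v)⁻¹, by rw [hk.map_mul, hπk, hw, add_zero], ?_⟩
  rw [mul_pow, inv_pow, mul_pow, hv, _root_.map_mul]
  field_simp

/-- If a totally ramified and an unramified subextension have complementary degrees, then `E`
contains an `e`-th root of a uniformizer of `k`. -/
lemma exists_root_of_tensor_decomposition (hk : IsLocalValuation k νk 1 q)
    (hE : IsLocalValuation E νE e qE) (hcompat : ∀ c : k, νE (algebraMap k E c) = νk c)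
    [FiniteDimensional k E] (hdeg : Module.finrank k E = e * f) (hf : qE = q ^ f)
    (he : (e : ResidueField hE.valuationSubring) ≠ 0) (T L : IntermediateField k E)
    (hT : ∃ π : T, νE (π : E) = (((Module.finrank k T : ℝ)⁻¹ : ℝ) : EReal))
    (hL : ∀ x : L, (x : E) ≠ 0 → ∃ m : ℤ, νE (x : E) = ((m : ℝ) : EReal))
    (hTL : Module.finrank k T * Module.finrank k L = Module.finrank k E) :
    ∃ (πk : k) (α : E), νk πk = (1 : EReal) ∧ α ^ e = algebraMap k E πk := by
  have he0 : (e : ℝ) ≠ 0 := Nat.cast_ne_zero.2 hE.e_pos.ne'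
  obtain ⟨π, hπ⟩ := hT
  have hTe : Module.finrank k T = e := by
    have hLf := hk.finrank_le_of_forall_exists_int hE hcompat hdeg hf L hL
    have hL0 : 0 < Module.finrank k L := Module.finrank_pos
    have hT0 : (Module.finrank k T : ℝ) ≠ 0 :=
      Nat.cast_ne_zero.2 (Module.finrank_pos (R := k) (M := T)).ne'
    refine le_antisymm ?_ ?_
    · obtain ⟨m, hm⟩ := hE.values π (hE.ne_zero_of_eq_coe hπ)
      rw [hπ, EReal.coe_eq_coe_iff] at hm
      field_simp at hm
      have hm' : (e : ℤ) = Module.finrank k T * m := by exact_mod_cast hm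
      exact Nat.le_of_dvd hE.e_pos (Int.natCast_dvd_natCast.1 ⟨m, hm'⟩)
    · refine Nat.le_of_mul_le_mul_right ?_ hL0
      rw [hTL, hdeg]
      exact Nat.mul_le_mul_left _ hLf
  rw [hTe] at hπ
  have hπ0 := hE.ne_zero_of_eq_coe hπ
  have hint (a : Fin e → k) (j : Fin e) (hj : algebraMap k E (a j) ≠ 0) :
      ∃ m : ℤ, νE (algebraMap k E (a j)) = ((m : ℝ) : EReal) := by
    rw [hcompat]
    exact hk.exists_int ((_root_.map_ne_zero _).1 hj)
  have hli : LinearIndependent k fun j : Fin e => π ^ (j : ℕ) := by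
    rw [Fintype.linearIndependent_iff]
    intro a ha j
    have h1 := hE.map_sum_mul_pow_le hπ (fun j => algebraMap k E (a j)) (hint a) j
    have h2 : ∑ j, algebraMap k E (a j) * (π : E) ^ (j : ℕ) = 0 := by
      simpa [Algebra.smul_def] using congrArg (algebraMap T E) ha
    rw [h2, hE.map_zero, top_le_iff, hE.eq_top_iff, mul_eq_zero,
      or_iff_left (pow_ne_zero _ hπ0)] at h1
    exact (map_eq_zero _).1 h1
  obtain ⟨πk, hπk⟩ := hk.exists_uniformizer
  have hπk1 : νk πk = ((1 : ℝ) : EReal) := by simpa using hπk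
  let x : T := π ^ e * (algebraMap k T πk)⁻¹
  have hx : νE (x : E) = 0 := by
    have h1 : νE (algebraMap k E πk) = ((1 : ℝ) : EReal) := by rw [hcompat, hπk1]
    have h2 := hE.map_mul_coe (hE.map_pow hπ e) (hE.map_inv h1)
    rw [mul_inv_cancel₀ he0, add_neg_cancel, EReal.coe_zero] at h2
    exact h2
  obtain ⟨a, ha⟩ : ∃ a : Fin e → k, ∑ j, a j • π ^ (j : ℕ) = x := by
    rw [← Submodule.mem_span_range_iff_exists_fun,
      hli.span_eq_top_of_card_eq_finrank' (by simp [hTe])]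
    trivial
  have ha' : ∑ j, algebraMap k E (a j) * (π : E) ^ (j : ℕ) = x := by
    simpa [Algebra.smul_def] using congrArg (algebraMap T E) ha
  have hle := hE.map_sum_mul_pow_le hπ (fun j => algebraMap k E (a j)) (hint a)
  rw [ha', hx] at hle
  let j₀ : Fin e := ⟨0, hE.e_pos⟩
  have hlt : 0 < νE ((x : E) - algebraMap k E (a j₀)) := by
    rw [← ha', ← Finset.add_sum_erase _ _ (Finset.mem_univ j₀)]
    simp only [j₀, pow_zero, mul_one, add_sub_cancel_left]
    refine hE.lt_map_sum _ _ EReal.zero_ne_top fun j hj => lt_of_le_of_ne (hle j) fun h0 => ?_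
    have hj0 : (j : ℕ) ≠ 0 := fun h => Finset.ne_of_mem_erase hj (Fin.ext h)
    have hne : algebraMap k E (a j) ≠ 0 := by
      intro h1
      rw [h1, zero_mul, hE.map_zero] at h0
      exact EReal.zero_ne_top h0
    obtain ⟨m, hm⟩ := hint a j hne
    rw [hE.map_mul_coe hm (hE.map_pow hπ _), ← EReal.coe_zero, EReal.coe_eq_coe_iff] at h0
    field_simp at h0
    rw [zero_mul] at h0
    have h1 : (0 : ℤ) = m * e + (j : ℕ) := by exact_mod_cast h0
    have h2 : (e : ℤ) ∣ (j : ℕ) := ⟨-m, by linarith⟩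
    exact hj0 (Nat.eq_zero_of_dvd_of_lt (Int.natCast_dvd_natCast.1 h2) j.2)
  have ha0 : νk (a j₀) = 0 := by
    have h0 : 0 ≤ νk (a j₀) := by simpa [j₀, hcompat] using hle j₀
    refine le_antisymm (not_lt.1 fun h1 => ?_) h0
    rw [← hcompat] at h1
    have := hE.lt_map_add hlt h1
    rw [sub_add_cancel, hx] at this
    exact lt_irrefl _ this
  refine hk.exists_root_of_congr hE hcompat he hπ (πk := πk) hπk1 hE.map_one ha0 ?_
  rw [one_pow, one_mul]
  exact hlt

lemma pow_sub_one_pos_of_root (hk : IsLocalValuation k νk 1 q)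
    (hE : IsLocalValuation E νE e qE) (hcompat : ∀ c : k, νE (algebraMap k E c) = νk c)
    (hf : qE = q ^ f) {πk : k} {α : E} (hπk : νk πk = (1 : EReal))
    (hα : α ^ e = algebraMap k E πk) (πE : E) (πk' : k)
    (hπE : νE πE = (((e : ℝ)⁻¹ : ℝ) : EReal)) (hπk' : νk πk' = (1 : EReal)) :
    0 < νE ((πE ^ e * (algebraMap k E πk')⁻¹) ^
      ((qE - 1) / Nat.gcd ((qE - 1) / (q - 1)) e) - 1) := by
  have h1 : νk πk = ((1 : ℝ) : EReal) := hπk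
  have h1' : νk πk' = ((1 : ℝ) : EReal) := hπk'
  have hπk0 : πk ≠ 0 := hk.ne_zero_of_eq_coe h1
  have hu : νE (πE * α⁻¹) = 0 := by
    rw [hE.map_mul_coe hπE (hE.map_inv (hk.map_root hE hcompat hπk hα))]
    simp
  have hw : νk (πk * πk'⁻¹) = 0 := by
    rw [hk.map_mul_coe h1 (hk.map_inv h1')]
    simp
  have heq : πE ^ e * (algebraMap k E πk')⁻¹ =
      (πE * α⁻¹) ^ e * algebraMap k E (πk * πk'⁻¹) := by
    rw [mul_pow, inv_pow, hα, _root_.map_mul, map_inv₀, mul_assoc, inv_mul_cancel_left₀]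
    exact (_root_.map_ne_zero _).2 hπk0
  have hdvd : q - 1 ∣ qE - 1 := by
    rw [hf]
    simpa using Nat.sub_dvd_pow_sub_pow q 1 f
  have hq0 : 0 < q - 1 := Nat.sub_pos_of_lt hk.one_lt_q
  obtain ⟨M, hM⟩ := hdvd
  obtain ⟨M', hM'⟩ : Nat.gcd M e ∣ M := Nat.gcd_dvd_left M e
  obtain ⟨e', he'⟩ : Nat.gcd M e ∣ e := Nat.gcd_dvd_right M e
  have hd0 : 0 < Nat.gcd M e := Nat.gcd_pos_of_pos_right _ hE.e_pos
  have hexp : (qE - 1) / Nat.gcd M e = (q - 1) * M' := by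
    rw [hM]
    conv_lhs => enter [1]; rw [hM']
    rw [mul_left_comm, Nat.mul_div_cancel_left _ hd0]
  have hexp' : e * ((q - 1) * M') = (qE - 1) * e' := by
    rw [hM]
    conv_lhs => rw [he']
    conv_rhs => rw [hM']
    ring
  rw [hM, Nat.mul_div_cancel_left _ hq0, ← hM, hexp, heq, mul_pow, ← pow_mul, hexp',
    pow_mul, ← _root_.map_pow, pow_mul (πk * πk'⁻¹)]
  refine hE.sub_one_pos_mul (hE.sub_one_pos_pow (hE.pow_card_sub_one hu) _) ?_
  rw [← (algebraMap k E).map_one, ← map_sub, hcompat]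
  exact hk.sub_one_pos_pow (hk.pow_card_sub_one hw) _

lemma exists_root_of_pow_sub_one_pos (hk : IsLocalValuation k νk 1 q)
    (hE : IsLocalValuation E νE e qE) (hcompat : ∀ c : k, νE (algebraMap k E c) = νk c)
    (hf : qE = q ^ f) (he : (e : ResidueField hE.valuationSubring) ≠ 0) {πE : E} {πk : k}
    (hπE : νE πE = (((e : ℝ)⁻¹ : ℝ) : EReal)) (hπk : νk πk = (1 : EReal))
    (h : 0 < νE ((πE ^ e * (algebraMap k E πk)⁻¹) ^
      ((qE - 1) / Nat.gcd ((qE - 1) / (q - 1)) e) - 1)) :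
    ∃ (πk : k) (α : E), νk πk = (1 : EReal) ∧ α ^ e = algebraMap k E πk := by
  let := (hk.ringHom hE hcompat).toAlgebra
  have : IsLocalHom (algebraMap hk.valuationSubring hE.valuationSubring) :=
    hk.isLocalHom_ringHom hE hcompat
  have := hE.finite_residueField
  have := hk.finite_residueField
  have he0 : (e : ℝ) ≠ 0 := Nat.cast_ne_zero.2 hE.e_pos.ne'
  have hx : νE (πE ^ e * (algebraMap k E πk)⁻¹) = 0 := by
    have h1 : νE (algebraMap k E πk) = ((1 : ℝ) : EReal) := by rw [hcompat, hπk]; rfl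
    have h2 := hE.map_mul_coe (hE.map_pow hπE e) (hE.map_inv h1)
    rwa [mul_inv_cancel₀ he0, add_neg_cancel, EReal.coe_zero] at h2
  have hxmem : πE ^ e * (algebraMap k E πk)⁻¹ ∈ hE.valuationSubring := hx.ge
  let x : hE.valuationSubring := ⟨_, hxmem⟩
  have hx0 : IsLocalRing.residue hE.valuationSubring x ≠ 0 := by
    rw [residue_ne_zero_iff_isUnit, hE.isUnit_iff]
    exact hx
  have hdvd : q - 1 ∣ qE - 1 := by
    rw [hf]
    simpa using Nat.sub_dvd_pow_sub_pow q 1 f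
  obtain ⟨u', w', huw⟩ := FiniteField.exists_eq_pow_mul_algebraMap
    (F := ResidueField hk.valuationSubring) e hE.e_pos
    (by rwa [hk.card_residueField, hE.card_residueField]) hx0 (by
      rw [hk.card_residueField, hE.card_residueField, ← _root_.map_pow,
        ← (IsLocalRing.residue hE.valuationSubring).map_one, hE.residue_eq_iff]
      exact h)
  obtain ⟨u, rfl⟩ := residue_surjective u'
  obtain ⟨w, rfl⟩ := residue_surjective w'
  have hw0 : IsLocalRing.residue hk.valuationSubring w ≠ 0 := by
    intro h0
    rw [h0, _root_.map_zero, mul_zero] at huw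
    exact hx0 huw
  have hu0 : IsLocalRing.residue hE.valuationSubring u ≠ 0 := by
    intro h0
    rw [h0, zero_pow hE.e_pos.ne', zero_mul] at huw
    exact hx0 huw
  rw [residue_ne_zero_iff_isUnit, isUnit_iff] at hw0 hu0
  have huw' : IsLocalRing.residue hE.valuationSubring x = IsLocalRing.residue hE.valuationSubring
      (u ^ e * algebraMap hk.valuationSubring hE.valuationSubring w) := by
    rw [huw, _root_.map_mul, _root_.map_pow]
    rfl
  rw [hE.residue_eq_iff] at huw'
  exact hk.exists_root_of_congr hE hcompat he hπE hπk hu0 hw0 huw'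

end Extension

end IsLocalValuation

/-- Let `E|k` be a finite tamely ramified extension of non-Archimedean
local fields (`e = e(E|k)` coprime to the residue characteristic `p`), `q = #κ_k`,
`qE = #κ_E = q^f`, `ẽ = gcd((qE-1)/(q-1), e)`.  The following are equivalent:
1. `E` is `k`-algebra isomorphic to a tensor product `T ⊗_k L` of a totally ramified
   extension `T|k` and an unramified extension `L|k` (equivalently, there are
   intermediate fields `T`, `L` of `E|k`, `T` totally ramified and `L` unramified over
   `k`, with `[T:k]·[L:k] = [E:k]` and compositum `E`);
2. `E` contains an `e`-th root of some uniformizer of `k`;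
3. `1 ∈ μ_tame(E|k)`;
4. there are uniformizers `π_E` of `E` and `π_k` of `k` with
   `(π_E^e π_k⁻¹)^{(qE-1)/ẽ} ∈ 1 + 𝔭_E`;
5. for all uniformizers `π_E` of `E` and `π_k` of `k`, the element
   `(π_E^e π_k⁻¹)^{(qE-1)/ẽ}` lies in `1 + 𝔭_E`. -/
theorem stmt_6
    {k E : Type*} [Field k] [Field E] [Algebra k E] [FiniteDimensional k E]
    (νk : k → EReal) (νE : E → EReal) (e f q qE : ℕ)
    (hk : IsLocalValuation k νk 1 q) (hE : IsLocalValuation E νE e qE)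
    (hcompat : ∀ c : k, νE (algebraMap k E c) = νk c)
    (hdeg : Module.finrank k E = e * f) (hresdeg : qE = q ^ f)
    (p : ℕ) (hp : p.Prime) (hqp : ∃ n : ℕ, q = p ^ n)
    (htame : Nat.Coprime e p) :
    List.TFAE
      [(∃ T L : IntermediateField k E,
          (∃ π : T, νE (π : E) = (((Module.finrank k T : ℝ)⁻¹ : ℝ) : EReal)) ∧
          (∀ x : L, (x : E) ≠ 0 → ∃ m : ℤ, νE (x : E) = ((m : ℝ) : EReal)) ∧
          Module.finrank k T * Module.finrank k L = Module.finrank k E ∧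
          T ⊔ L = ⊤),
        (∃ (πk : k) (α : E), νk πk = (1 : EReal) ∧ α ^ e = algebraMap k E πk),
        (∃ πE : E, νE πE = (((e : ℝ)⁻¹ : ℝ) : EReal) ∧
          ∃ y : k, 0 ≤ νk y ∧ algebraMap k E y = πE ^ e * (1 : E)⁻¹),
        (∃ (πE : E) (πk : k), νE πE = (((e : ℝ)⁻¹ : ℝ) : EReal) ∧ νk πk = (1 : EReal) ∧
          0 < νE ((πE ^ e * (algebraMap k E πk)⁻¹) ^
            ((qE - 1) / Nat.gcd ((qE - 1) / (q - 1)) e) - 1)),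
        (∀ (πE : E) (πk : k), νE πE = (((e : ℝ)⁻¹ : ℝ) : EReal) → νk πk = (1 : EReal) →
          0 < νE ((πE ^ e * (algebraMap k E πk)⁻¹) ^
            ((qE - 1) / Nat.gcd ((qE - 1) / (q - 1)) e) - 1))] := by
  obtain ⟨n, hn⟩ := hqp
  have he := hE.natCast_residueField_ne_zero (p := p) (a := n * f)
    (by rw [hresdeg, hn, pow_mul]) htame
  have hπ := hE.exists_uniformizer
  have hπk := hk.exists_uniformizer
  simp only [Nat.cast_one, inv_one, EReal.coe_one] at hπk
  tfae_have 1 → 2 := by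
    rintro ⟨T, L, hT, hL, hTL, -⟩
    exact hk.exists_root_of_tensor_decomposition hE hcompat hdeg hresdeg he T L hT hL hTL
  tfae_have 2 → 1 := by
    rintro ⟨πk, α, h1, h2⟩
    exact hk.exists_tensor_decomposition hE hcompat hdeg hresdeg h1 h2
  tfae_have 2 → 3 := by
    rintro ⟨πk, α, h1, h2⟩
    refine ⟨α, hk.map_root hE hcompat h1 h2, πk, ?_, by rw [inv_one, mul_one, h2]⟩
    rw [h1]
    exact zero_le_one
  tfae_have 3 → 2 := by
    rintro ⟨πE, h1, y, -, h2⟩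
    rw [inv_one, mul_one] at h2
    refine ⟨y, πE, ?_, h2.symm⟩
    rw [← hcompat, h2, hE.map_pow h1, mul_inv_cancel₀ (Nat.cast_ne_zero.2 hE.e_pos.ne'),
      EReal.coe_one]
  tfae_have 2 → 5 := by
    rintro ⟨πk, α, h1, h2⟩
    exact hk.pow_sub_one_pos_of_root hE hcompat hresdeg h1 h2
  tfae_have 5 → 4 := by
    intro h
    obtain ⟨πE, hπE⟩ := hπ
    obtain ⟨πk, hπk⟩ := hπk
    exact ⟨πE, πk, hπE, hπk, h πE πk hπE hπk⟩
  tfae_have 4 → 2 := by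
    rintro ⟨πE, πk, h1, h2, h3⟩
    exact hk.exists_root_of_pow_sub_one_pos hE hcompat hresdeg he h1 h2 h3
  tfae_finish
end
end

section
/- There is a unique bi-additive map h^φ : V × V → E ⊗_k D such that: (1) h^φ(va, wb) = (σ′⊗ρ)(a)·h^φ(v,w)·b and (σ′⊗ρ)(h^φ(v,w)) = ε·h^φ(w,v) for all a, b ∈ E ⊗_k D and v, w ∈ V (where V carries the right E ⊗_k D-module structure induced by φ), and (2) λ̃ ∘ h^φ = h. -/
noncomputable section

open scoped TensorProduct

/-- For a nonzero linear form `lam` on a finite field extension, the form `(x, y) ↦ lam (x * y)`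
admits a pair of dual bases. -/
theorem exists_dual_bases {k E : Type*} [Field k] [Field E] [Algebra k E] [FiniteDimensional k E]
    (lam : E →ₗ[k] k) (hlam : lam ≠ 0) :
    ∃ (n : ℕ) (b c : Fin n → E), (∀ z, z = ∑ i, lam (z * c i) • b i) ∧
      ∀ z, z = ∑ i, lam (b i * z) • c i := by
  classical
  let B : LinearMap.BilinForm k E := (LinearMap.mul k E).compr₂ lam
  have hBapp (x y : E) : B x y = lam (x * y) := rfl
  have hB : B.Nondegenerate := by
    have key (x : E) (hx : ∀ y, lam (x * y) = 0) : x = 0 := by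
      by_contra hx0
      refine hlam (LinearMap.ext fun y => ?_)
      simpa [mul_inv_cancel_left₀ hx0] using hx (x⁻¹ * y)
    exact ⟨fun x hx => key x hx, fun y hy => key y fun x => by
      rw [mul_comm, ← hBapp]
      exact hy x⟩
  let b := Module.finBasis k E
  let c := B.dualBasis hB b
  have hcb (i j) : lam (b i * c j) = if i = j then 1 else 0 := by
    have := LinearMap.BilinForm.apply_dualBasis_left hB b j i
    rw [mul_comm]
    exact this
  refine ⟨_, b, c, fun z => ?_, fun z => ?_⟩
  · have hr (i) : lam (z * c i) = b.repr z i := by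
      conv_lhs => rw [← b.sum_repr z]
      rw [Finset.sum_mul, map_sum]
      simp [hcb]
    simp_rw [hr]
    exact (b.sum_repr z).symm
  · have hr (i) : lam (b i * z) = c.repr z i := by
      conv_lhs => rw [← c.sum_repr z]
      rw [Finset.mul_sum, map_sum]
      simp [hcb]
    simp_rw [hr]
    exact (c.sum_repr z).symm

/-- Setting: `k` a non-Archimedean local field of odd residue
characteristic, `D` a central division `k`-algebra of index `d ∈ {1,2}`, `ρ` an
involution of `D` with `ρ(k) = k` (with restriction `ρ₀` to `k`), `V` a
finite-dimensional right `D`-vector space (a `Dᵐᵒᵖ`-module), `h` a non-degenerate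
`ε`-Hermitian form on `V` with adjoint involution `σ` on `End_D(V)`, `E|k` a finite
extension with an automorphism `σ′` extending `ρ|_k` and `σ′² = id`, `λ : E → k` a
non-zero `k`-linear map, equivariant and adapted to the valuations, `λ̃ : E ⊗_k D → D`
its extension `x ⊗ y ↦ λ(x)·y`, `σ′⊗ρ` the induced involution of `E ⊗_k D`, and
`φ : E → End_D(V)` a `σ′`-`σ`-equivariant `k`-algebra homomorphism (inducing the right
`E ⊗_k D`-module structure `v·(x ⊗ y) = φ(x)(v)·y` on `V`).
Conclusion: there is a unique bi-additive map `h^φ : V × V → E ⊗_k D` such that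
`h^φ(va, wb) = (σ′⊗ρ)(a)·h^φ(v,w)·b` and `(σ′⊗ρ)(h^φ(v,w)) = ε·h^φ(w,v)` for all
`a, b ∈ E ⊗_k D`, `v, w ∈ V`, and `λ̃ ∘ h^φ = h`. -/
theorem stmt_9
    {k D V E : Type*} [Field k] [DivisionRing D] [Algebra k D]
    [AddCommGroup V] [Module Dᵐᵒᵖ V] [Module k V]
    [IsScalarTower k Dᵐᵒᵖ V] [SMulCommClass Dᵐᵒᵖ k V] [Module.Finite Dᵐᵒᵖ V]
    [Field E] [Algebra k E] [FiniteDimensional k E]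
    -- local field data
    (νk : k → EReal) (νE : E → EReal) (e f q qE d : ℕ)
    (hk : IsLocalValuation k νk 1 q) (hE : IsLocalValuation E νE e qE)
    (hcompat : ∀ c : k, νE (algebraMap k E c) = νk c)
    (hdeg : Module.finrank k E = e * f) (hresdeg : qE = q ^ f)
    (hoddres : νk 2 = 0)
    -- D is central of index d ∈ {1, 2}
    (hd : d = 1 ∨ d = 2) (hdim : Module.finrank k D = d * d)
    (hcentral : ∀ z : D, (∀ w, z * w = w * z) → ∃ c : k, algebraMap k D c = z)
    -- involution ρ of D restricting to ρ₀ on k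
    (ρ : D → D) (ρ₀ : k → k)
    (hρadd : ∀ x y, ρ (x + y) = ρ x + ρ y)
    (hρmul : ∀ x y, ρ (x * y) = ρ y * ρ x)
    (hρinv : ∀ x, ρ (ρ x) = x)
    (hρk : ∀ c : k, ρ (algebraMap k D c) = algebraMap k D (ρ₀ c))
    -- ε-Hermitian form h with adjoint involution σ
    (ε : k) (hε : ε = 1 ∨ ε = -1)
    (h : V → V → D)
    (haddl : ∀ v v' w, h (v + v') w = h v w + h v' w)
    (haddr : ∀ v w w', h v (w + w') = h v w + h v w')
    (hherm : ∀ (a b : D) (v w : V),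
      h (MulOpposite.op a • v) (MulOpposite.op b • w) = ρ a * (ε • ρ (h w v)) * b)
    (hnd : ∀ v, (∀ w, h v w = 0) → v = 0)
    (σ : Module.End Dᵐᵒᵖ V → Module.End Dᵐᵒᵖ V)
    (hσ : ∀ (a : Module.End Dᵐᵒᵖ V) (v w : V), h (a v) w = h v (σ a w))
    -- σ′ and λ
    (σ' : E ≃+* E) (hσ'2 : ∀ x, σ' (σ' x) = x)
    (hσ'k : ∀ c : k, σ' (algebraMap k E c) = algebraMap k E (ρ₀ c))
    (lam : E →ₗ[k] k) (hlam0 : lam ≠ 0)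
    (hlamequi : ∀ x, lam (σ' x) = ρ₀ (lam x))
    (hlamval : ∀ x : E, σ' x = x →
      (0 < νE x ↔ ∀ y : E, σ' y = y → 0 ≤ νE y → 0 < νk (lam (x * y))))
    -- λ̃ and σ′⊗ρ
    (lt : TensorProduct k E D →+ D)
    (hlt : ∀ (x : E) (y : D), lt (x ⊗ₜ[k] y) = lam x • y)
    (sInv : TensorProduct k E D →+ TensorProduct k E D)
    (hsInv : ∀ (x : E) (y : D), sInv (x ⊗ₜ[k] y) = σ' x ⊗ₜ[k] ρ y)
    -- φ, σ′-σ-equivariant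
    (φ : E →ₐ[k] Module.End Dᵐᵒᵖ V)
    (hφequi : ∀ x, φ (σ' x) = σ (φ x)) :
    ∃! hphi : V →+ V →+ TensorProduct k E D,
      (∀ (x x' : E) (y y' : D) (v w : V),
        hphi (MulOpposite.op y • φ x v) (MulOpposite.op y' • φ x' w)
          = sInv (x ⊗ₜ[k] y) * hphi v w * (x' ⊗ₜ[k] y')) ∧
      (∀ v w : V, sInv (hphi v w) = ε • hphi w v) ∧
      (∀ v w : V, lt (hphi v w) = h v w) := by
  obtain ⟨n, b, c, hb, hc⟩ := exists_dual_bases lam hlam0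
  have hρ0 : ρ 0 = 0 := by simpa using hρadd 0 0
  have hρ1 : ρ 1 = 1 := by
    have := hρmul 1 (ρ 1)
    rwa [one_mul, hρinv, one_mul, eq_comm] at this
  have hεε : ε * ε = 1 := by rcases hε with rfl | rfl <;> simp
  have hr (v w : V) (y : D) : h v (MulOpposite.op y • w) = h v w * y := by
    have h1 := hherm 1 y v w
    have h2 := hherm 1 1 v w
    simp only [MulOpposite.op_one, one_smul, hρ1, one_mul, mul_one] at h1 h2
    rw [h1, h2]
  have hl (v w : V) (y : D) : h (MulOpposite.op y • v) w = ρ y * h v w := by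
    have h1 := hherm y 1 v w
    have h2 := hherm 1 1 v w
    simp only [MulOpposite.op_one, one_smul, hρ1, one_mul, mul_one] at h1 h2
    rw [h1, h2]
  have hsymm (v w : V) : ρ (h v w) = ε • h w v := by
    have h2 := hherm 1 1 w v
    simp only [MulOpposite.op_one, one_smul, hρ1, one_mul, mul_one] at h2
    rw [h2, smul_smul, hεε, one_smul]
  have hrk (v w : V) (a : k) : h v (a • w) = a • h v w := by
    have : a • w = MulOpposite.op (algebraMap k D a) • w := by
      rw [← one_smul Dᵐᵒᵖ w, ← smul_assoc, ← smul_assoc, Algebra.algebraMap_eq_smul_one]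
      simp
    rw [this, hr, ← Algebra.commutes, Algebra.smul_def]
  let hR (v : V) : V →+ D := AddMonoidHom.mk' (h v) (haddr v)
  have hadj (x : E) (v w : V) : h (φ x v) w = h v (φ (σ' x) w) := by rw [hφequi, hσ]
  have lt_mul_tmul (t : TensorProduct k E D) (y : D) : lt (t * (1 ⊗ₜ[k] y)) = lt t * y := by
    induction t with
    | zero => simp
    | add s t hs ht => simp [add_mul, hs, ht]
    | tmul x d => simp [hlt]
  have lt_tmul_mul (t : TensorProduct k E D) (y : D) : lt ((1 ⊗ₜ[k] y) * t) = y * lt t := by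
    induction t with
    | zero => simp
    | add s t hs ht => simp [mul_add, hs, ht]
    | tmul x d => simp [hlt]
  have tmul_one_comm (t : TensorProduct k E D) (x : E) :
      (x ⊗ₜ[k] (1 : D)) * t = t * (x ⊗ₜ[k] 1) := by
    induction t with
    | zero => simp
    | add s t hs ht => simp [mul_add, add_mul, hs, ht]
    | tmul z d => simp [mul_comm]
  have lt_smul (t : TensorProduct k E D) (a : k) : lt (a • t) = a • lt t := by
    induction t with
    | zero => simp
    | add s t hs ht => simp [hs, ht]
    | tmul z d => simp [hlt, TensorProduct.smul_tmul', mul_smul]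
  have lt_sInv (t : TensorProduct k E D) (z : E) :
      lt ((z ⊗ₜ[k] 1) * sInv t) = ρ (lt ((σ' z ⊗ₜ[k] 1) * t)) := by
    induction t with
    | zero => simp [hρ0]
    | add s t hs ht => simp [mul_add, hs, ht, hρadd]
    | tmul x d =>
      have : z * σ' x = σ' (σ' z * x) := by rw [map_mul, hσ'2]
      simp only [hsInv, Algebra.TensorProduct.tmul_mul_tmul, one_mul, hlt, this, hlamequi]
      rw [Algebra.smul_def, Algebra.smul_def, hρmul, hρk, Algebra.commutes]
  have reconstruct (t : TensorProduct k E D) :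
      t = ∑ i, c i ⊗ₜ[k] lt ((b i ⊗ₜ[k] 1) * t) := by
    induction t with
    | zero => simp
    | add s t hs ht =>
      simp only [mul_add, map_add, TensorProduct.tmul_add, Finset.sum_add_distrib]
      rw [← hs, ← ht]
    | tmul x d =>
      conv_lhs => rw [hc x, TensorProduct.sum_tmul]
      simp [hlt, TensorProduct.smul_tmul]
  have separate {s t : TensorProduct k E D}
      (hst : ∀ z : E, lt ((z ⊗ₜ[k] 1) * s) = lt ((z ⊗ₜ[k] 1) * t)) : s = t := by
    rw [reconstruct s, reconstruct t]
    simp_rw [hst]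
  let F : V →+ V →+ TensorProduct k E D := AddMonoidHom.mk'
    (fun v => AddMonoidHom.mk' (fun w => ∑ i, c i ⊗ₜ[k] h v (φ (b i) w)) fun w w' => by
      simp [haddr, TensorProduct.tmul_add, Finset.sum_add_distrib])
    fun v v' => by
      ext w
      simp [haddl, TensorProduct.tmul_add, Finset.sum_add_distrib]
  have hF (v w : V) : F v w = ∑ i, c i ⊗ₜ[k] h v (φ (b i) w) := rfl
  have lt_F (z : E) (v w : V) : lt ((z ⊗ₜ[k] 1) * F v w) = h v (φ z w) := by
    have hz : h v (φ z w) = ∑ i, lam (z * c i) • h v (φ (b i) w) := by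
      conv_lhs => rw [hb z, map_sum, LinearMap.sum_apply]
      refine (map_sum (hR v) _ _).trans (Finset.sum_congr rfl fun i _ => ?_)
      rw [map_smul, LinearMap.smul_apply]
      exact hrk _ _ _
    rw [hz, hF, Finset.mul_sum, map_sum]
    simp [hlt]
  refine ⟨F, ⟨fun x x' y y' v w => separate fun z => ?_, fun v w => separate fun z => ?_,
    fun v w => ?_⟩, fun G ⟨hG1, _, hG3⟩ => ?_⟩
  · have e1 : (z ⊗ₜ[k] (1 : D)) * (sInv (x ⊗ₜ[k] y) * F v w * (x' ⊗ₜ[k] y'))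
        = (1 ⊗ₜ[k] ρ y) * (((z * σ' x * x') ⊗ₜ[k] 1) * F v w) * (1 ⊗ₜ[k] y') := by
      have a1 : (x' ⊗ₜ[k] y') = (x' ⊗ₜ[k] (1 : D)) * (1 ⊗ₜ[k] y') := by simp
      have a2 : (1 ⊗ₜ[k] ρ y) * ((z * σ' x * x') ⊗ₜ[k] (1 : D))
          = (z ⊗ₜ[k] 1) * (σ' x ⊗ₜ[k] ρ y) * (x' ⊗ₜ[k] 1) := by simp
      rw [a1, hsInv, ← mul_assoc (1 ⊗ₜ[k] ρ y), a2]
      simp only [mul_assoc]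
      rw [← mul_assoc (F v w), ← tmul_one_comm (F v w) x', mul_assoc]
    rw [lt_F, e1, lt_mul_tmul, lt_tmul_mul, lt_F, map_smul, hr, hl, hadj]
    congr 3
    rw [mul_comm z, map_mul, map_mul]
    rfl
  · rw [lt_sInv, lt_F, ← hadj, hsymm, mul_smul_comm, lt_smul, lt_F]
  · have := lt_F 1 v w
    rwa [← Algebra.TensorProduct.one_def, one_mul, map_one] at this
  · ext v w
    refine separate fun z => ?_
    have := hG1 1 z 1 1 v w
    rw [hsInv, map_one, map_one, hρ1, ← Algebra.TensorProduct.one_def, one_mul,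
      MulOpposite.op_one, one_smul, one_smul, Module.End.one_apply] at this
    rw [lt_F, tmul_one_comm, ← this, hG3]
end
end

section
/- Let φ and φ′ be two σ′-σ-equivariant k-algebra homomorphisms from E into End_D(V), and let h^φ and h^{φ′} be the associated extended forms. Then there exists g ∈ U(h) with φ′(x) = g ∘ φ(x) ∘ g^{−1} for all x ∈ E if and only if (V, h^φ) is isomorphic to (V, h^{φ′}) as signed Hermitian E ⊗_k D-modules, i.e. there exists an additive bijection u : V → V with u(v·_φ a) = u(v)·_{φ′} a for all a ∈ E ⊗_k D and h^{φ′}(u(v), u(w)) = h^φ(v,w) for all v, w ∈ V (where ·_φ and ·_{φ′} denote the module structures induced by φ and φ′). -/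
noncomputable section

open scoped TensorProduct

/-- If `lam : E → k` is a nonzero functional on a field extension, then the pairing
`(z, x ⊗ 1) ↦ (lam ⊗ id) (z * (x ⊗ 1))` on `E ⊗ D` is nondegenerate on the left. -/
theorem TensorProduct.eq_zero_of_forall_lift_mul_eq_zero
    {k D E : Type*} [Field k] [Ring D] [Algebra k D] [Field E] [Algebra k E]
    {lam : E →ₗ[k] k} (hlam : lam ≠ 0) {lt : E ⊗[k] D →+ D}
    (hlt : ∀ (x : E) (y : D), lt (x ⊗ₜ[k] y) = lam x • y)
    {z : E ⊗[k] D} (hz : ∀ x : E, lt (z * (x ⊗ₜ[k] 1)) = 0) : z = 0 := by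
  obtain ⟨x₀, hx₀⟩ : ∃ x, lam x ≠ 0 := by
    by_contra! H
    exact hlam (LinearMap.ext H)
  let b := Module.Basis.ofVectorSpace k D
  obtain ⟨c, rfl⟩ := TensorProduct.eq_repr_basis_right b z
  have hc : c = 0 := by
    ext i
    by_contra hi
    have hzero := hz ((c i)⁻¹ * x₀)
    have hsum : ∑ j ∈ c.support, lam (c j * ((c i)⁻¹ * x₀)) • b j = 0 := by
      rw [← hzero, Finsupp.sum, Finset.sum_mul, map_sum]
      exact Finset.sum_congr rfl fun j _ => by
        rw [Algebra.TensorProduct.tmul_mul_tmul, mul_one, hlt]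
    have hcoeff := linearIndependent_iff'.mp b.linearIndependent _ _ hsum i
      (Finsupp.mem_support_iff.mpr hi)
    rw [mul_inv_cancel_left₀ hi] at hcoeff
    exact hx₀ hcoeff
  rw [hc, Finsupp.sum_zero_index]

/-- Setting as in the construction of extended Hermitian forms:
`k` a non-Archimedean local field of odd residue characteristic, `D` a central division
`k`-algebra of index `d ∈ {1,2}` with involution `ρ` (restricting to `ρ₀` on `k`), `V`
a finite-dimensional right `D`-vector space, `h` a non-degenerate `ε`-Hermitian form on
`V` with adjoint involution `σ`, `E|k` finite with automorphism `σ′` (with `σ′² = id`,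
`σ′|_k = ρ|_k`), `λ : E → k` as usual, `λ̃ = λ ⊗ id` and `σ′⊗ρ` on `E ⊗_k D`.
Let `φ, φ′ : E → End_D(V)` be `σ′`-`σ`-equivariant `k`-algebra homomorphisms and
`h^φ, h^{φ′}` the associated extended forms.  Then there exists `g ∈ U(h)` with
`φ′(x) = g ∘ φ(x) ∘ g⁻¹` for all `x ∈ E` if and only if `(V, h^φ) ≅ (V, h^{φ′})` as
signed Hermitian `E ⊗_k D`-modules: there is an additive bijection `u : V → V` with
`u(v ·_φ a) = u(v) ·_{φ′} a` for all `a ∈ E ⊗_k D` and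
`h^{φ′}(u v, u w) = h^φ(v, w)`. -/
theorem stmt_10
    {k D V E : Type*} [Field k] [DivisionRing D] [Algebra k D]
    [AddCommGroup V] [Module Dᵐᵒᵖ V] [Module k V]
    [IsScalarTower k Dᵐᵒᵖ V] [SMulCommClass Dᵐᵒᵖ k V] [Module.Finite Dᵐᵒᵖ V]
    [Field E] [Algebra k E] [FiniteDimensional k E]
    (νk : k → EReal) (νE : E → EReal) (e f q qE d : ℕ)
    (hk : IsLocalValuation k νk 1 q) (hE : IsLocalValuation E νE e qE)
    (hcompat : ∀ c : k, νE (algebraMap k E c) = νk c)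
    (hdeg : Module.finrank k E = e * f) (hresdeg : qE = q ^ f)
    (hoddres : νk 2 = 0)
    (hd : d = 1 ∨ d = 2) (hdim : Module.finrank k D = d * d)
    (hcentral : ∀ z : D, (∀ w, z * w = w * z) → ∃ c : k, algebraMap k D c = z)
    (ρ : D → D) (ρ₀ : k → k)
    (hρadd : ∀ x y, ρ (x + y) = ρ x + ρ y)
    (hρmul : ∀ x y, ρ (x * y) = ρ y * ρ x)
    (hρinv : ∀ x, ρ (ρ x) = x)
    (hρk : ∀ c : k, ρ (algebraMap k D c) = algebraMap k D (ρ₀ c))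
    (ε : k) (hε : ε = 1 ∨ ε = -1)
    (h : V → V → D)
    (haddl : ∀ v v' w, h (v + v') w = h v w + h v' w)
    (haddr : ∀ v w w', h v (w + w') = h v w + h v w')
    (hherm : ∀ (a b : D) (v w : V),
      h (MulOpposite.op a • v) (MulOpposite.op b • w) = ρ a * (ε • ρ (h w v)) * b)
    (hnd : ∀ v, (∀ w, h v w = 0) → v = 0)
    (σ : Module.End Dᵐᵒᵖ V → Module.End Dᵐᵒᵖ V)
    (hσ : ∀ (a : Module.End Dᵐᵒᵖ V) (v w : V), h (a v) w = h v (σ a w))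
    (σ' : E ≃+* E) (hσ'2 : ∀ x, σ' (σ' x) = x)
    (hσ'k : ∀ c : k, σ' (algebraMap k E c) = algebraMap k E (ρ₀ c))
    (lam : E →ₗ[k] k) (hlam0 : lam ≠ 0)
    (hlamequi : ∀ x, lam (σ' x) = ρ₀ (lam x))
    (hlamval : ∀ x : E, σ' x = x →
      (0 < νE x ↔ ∀ y : E, σ' y = y → 0 ≤ νE y → 0 < νk (lam (x * y))))
    (lt : TensorProduct k E D →+ D)
    (hlt : ∀ (x : E) (y : D), lt (x ⊗ₜ[k] y) = lam x • y)
    (sInv : TensorProduct k E D →+ TensorProduct k E D)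
    (hsInv : ∀ (x : E) (y : D), sInv (x ⊗ₜ[k] y) = σ' x ⊗ₜ[k] ρ y)
    -- the two equivariant embeddings φ, φ′
    (φ φ' : E →ₐ[k] Module.End Dᵐᵒᵖ V)
    (hφequi : ∀ x, φ (σ' x) = σ (φ x))
    (hφ'equi : ∀ x, φ' (σ' x) = σ (φ' x))
    -- the extended form h^φ
    (hphi : V →+ V →+ TensorProduct k E D)
    (hphi_sesq : ∀ (x x' : E) (y y' : D) (v w : V),
      hphi (MulOpposite.op y • φ x v) (MulOpposite.op y' • φ x' w)
        = sInv (x ⊗ₜ[k] y) * hphi v w * (x' ⊗ₜ[k] y'))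
    (hphi_sym : ∀ v w : V, sInv (hphi v w) = ε • hphi w v)
    (hphi_lift : ∀ v w : V, lt (hphi v w) = h v w)
    -- the extended form h^{φ′}
    (hphi' : V →+ V →+ TensorProduct k E D)
    (hphi'_sesq : ∀ (x x' : E) (y y' : D) (v w : V),
      hphi' (MulOpposite.op y • φ' x v) (MulOpposite.op y' • φ' x' w)
        = sInv (x ⊗ₜ[k] y) * hphi' v w * (x' ⊗ₜ[k] y'))
    (hphi'_sym : ∀ v w : V, sInv (hphi' v w) = ε • hphi' w v)
    (hphi'_lift : ∀ v w : V, lt (hphi' v w) = h v w) :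
    (∃ g : V ≃ₗ[Dᵐᵒᵖ] V, (∀ v w : V, h (g v) (g w) = h v w) ∧
        ∀ (x : E) (v : V), g (φ x v) = φ' x (g v)) ↔
    (∃ u : V ≃+ V,
        (∀ (x : E) (y : D) (v : V),
          u (MulOpposite.op y • φ x v) = MulOpposite.op y • φ' x (u v)) ∧
        ∀ v w : V, hphi' (u v) (u w) = hphi v w) := by
  have hsInv_one : sInv (1 ⊗ₜ[k] 1) = 1 := by
    have hρ1 : ρ 1 = 1 := by
      have := hρmul (ρ 1) 1
      rwa [mul_one, hρinv, mul_one, eq_comm] at this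
    rw [hsInv, map_one, hρ1, Algebra.TensorProduct.one_def]
  constructor
  · rintro ⟨g, hg, hgφ⟩
    refine ⟨g.toAddEquiv, fun x y v => ?_, fun v w => ?_⟩
    · change g (_ • φ x v) = _ • φ' x (g v)
      rw [map_smul, hgφ]
    · change hphi' (g v) (g w) = hphi v w
      refine sub_eq_zero.mp
        (TensorProduct.eq_zero_of_forall_lift_mul_eq_zero hlam0 hlt fun x => ?_)
      have hmul := hphi_sesq 1 x 1 1 v w
      have hmul' := hphi'_sesq 1 x 1 1 (g v) (g w)
      simp only [map_one, Module.End.one_apply, MulOpposite.op_one, one_smul, hsInv_one, one_mul]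
        at hmul hmul'
      rw [sub_mul, map_sub, ← hmul, ← hmul', hphi_lift, hphi'_lift, ← hgφ, hg, sub_self]
  · rintro ⟨u, hu, huh⟩
    have hu_smul (a : Dᵐᵒᵖ) (v : V) : u (a • v) = a • u v := by
      simpa using hu 1 a.unop v
    refine ⟨{ u with map_smul' := hu_smul }, fun v w => ?_, fun x v => ?_⟩
    · change h (u v) (u w) = h v w
      rw [← hphi'_lift, huh, hphi_lift]
    · change u (φ x v) = φ' x (u v)
      simpa using hu x 1 v
end
end
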